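/- Let T be a finite tree with vertex set V, let F : ℕ → ℕ be a percolation function, and fix a deadline t_* ∈ ℕ. Let v be a vertex with neighbors s_1, …, s_n, and let Q ⊆ V be an initially infected set with regards to which v is isolated (with deadline t_*); for each i let t_i^Q be the time at which s_i first becomes infected under the process started from Q, taken to be an arbitrarily large number if s_i is never infected. Let P ⊆ V be another initially infected set with v ∉ P, with corresponding first-infection times t_1^P, …, t_n^P of the neighbors, and suppose that for some index j one has t_i^Q = t_i^P for all i ≠ j and t_j^Q ≤ t_j^P. Then v is isolated with regards to P (with deadline t_*) as well. -/

import Mathlib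

/-- The `F(t)`-bootstrap percolation process on a finite simple graph `G`:
`perc G F A₀ t` is the set of infected vertices at time `t`, starting from the
initially infected set `A₀`, where at each step every vertex with at least
`F t` infected neighbors becomes infected. -/
def perc {V : Type*} [Fintype V] [DecidableEq V] (G : SimpleGraph V) [DecidableRel G.Adj]
    (F : ℕ → ℕ) (A₀ : Finset V) : ℕ → Finset V
  | 0 => A₀
  | (t + 1) =>
      perc G F A₀ t ∪
        Finset.univ.filter (fun v => F t ≤ ((G.neighborFinset v) ∩ perc G F A₀ t).card)
/-- The first time at which vertex `u` is infected in the `F(t)`-bootstrap percolation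
process started from `S`, as an extended natural number (`⊤` — an arbitrarily large
value — if `u` is never infected). -/
noncomputable def firstTime {V : Type*} [Fintype V] [DecidableEq V]
    (G : SimpleGraph V) [DecidableRel G.Adj] (F : ℕ → ℕ) (S : Finset V) (u : V) : ℕ∞ :=
  ⨅ (t : ℕ) (_ : u ∈ perc G F S t), (t : ℕ∞)

lemma perc_mono_time {V : Type*} [Fintype V] [DecidableEq V] (G : SimpleGraph V)
    [DecidableRel G.Adj] (F : ℕ → ℕ) (S : Finset V) : Monotone (perc G F S) := by
  refine monotone_nat_of_le_succ fun n => ?_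
  rw [perc]
  exact Finset.subset_union_left

lemma perc_mono_set {V : Type*} [Fintype V] [DecidableEq V] (G : SimpleGraph V)
    [DecidableRel G.Adj] (F : ℕ → ℕ) {S S' : Finset V} (h : S ⊆ S') (t : ℕ) :
    perc G F S t ⊆ perc G F S' t := by
  induction t with
  | zero => simpa [perc] using h
  | succ t ih =>
    intro u hu
    simp only [perc, Finset.mem_union, Finset.mem_filter, Finset.mem_univ, true_and] at hu ⊢
    rcases hu with hu | hu
    · exact Or.inl (ih hu)
    · exact Or.inr (hu.trans (Finset.card_le_card (Finset.inter_subset_inter_left ih)))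

lemma firstTime_le_iff {V : Type*} [Fintype V] [DecidableEq V] (G : SimpleGraph V)
    [DecidableRel G.Adj] (F : ℕ → ℕ) (S : Finset V) (u : V) (t : ℕ) :
    firstTime G F S u ≤ t ↔ u ∈ perc G F S t := by
  constructor
  · intro h
    by_contra hu
    have h2 : ((t + 1 : ℕ) : ℕ∞) ≤ firstTime G F S u := by
      refine le_iInf fun s => le_iInf fun hs => ?_
      by_contra hlt
      have hst : s ≤ t := by
        have : s < t + 1 := by exact_mod_cast not_le.mp hlt
        omega
      exact hu (perc_mono_time G F S hst hs)
    have h3 : t + 1 ≤ t := by exact_mod_cast h2.trans h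
    omega
  · intro h
    exact iInf₂_le t h

lemma perc_branch {V : Type*} [Fintype V] [DecidableEq V] (G : SimpleGraph V)
    [DecidableRel G.Adj] (F : ℕ → ℕ) (P : Finset V) (v w : V) (hw : w ≠ v) (t : ℕ)
    (hv : v ∉ perc G F (insert w P) t) (u : V) (huv : u ≠ v)
    (hu : ¬ ∃ p : G.Walk u w, v ∉ p.support) (hmem : u ∈ perc G F (insert w P) t) :
    u ∈ perc G F P t := by
  induction t generalizing u with
  | zero =>
    simp only [perc, Finset.mem_insert] at hmem ⊢
    rcases hmem with rfl | h
    · exact absurd ⟨SimpleGraph.Walk.nil, by simpa using hw.symm⟩ hu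
    · exact h
  | succ t ih =>
    have hv' : v ∉ perc G F (insert w P) t :=
      fun h => hv (perc_mono_time G F _ (Nat.le_succ t) h)
    simp only [perc, Finset.mem_union, Finset.mem_filter, Finset.mem_univ, true_and] at hmem ⊢
    rcases hmem with h | h
    · exact Or.inl (ih hv' u huv hu h)
    · refine Or.inr (h.trans (Finset.card_le_card ?_))
      intro x hx
      rw [Finset.mem_inter, SimpleGraph.mem_neighborFinset] at hx ⊢
      refine ⟨hx.1, ih hv' x ?_ ?_ hx.2⟩
      · rintro rfl
        exact hv' hx.2
      · rintro ⟨p, hp⟩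
        exact hu ⟨SimpleGraph.Walk.cons hx.1 p, by simp [hp, huv.symm]⟩

lemma branch_unique {V : Type*} [DecidableEq V] (G : SimpleGraph V) (hG : G.IsAcyclic)
    (v w a b : V) (ha : G.Adj v a) (hb : G.Adj v b)
    (hpa : ∃ p : G.Walk a w, v ∉ p.support) (hpb : ∃ p : G.Walk b w, v ∉ p.support) :
    a = b := by
  obtain ⟨p, hp⟩ := hpa
  obtain ⟨q, hq⟩ := hpb
  by_contra hab
  have hr : v ∉ (p.append q.reverse).bypass.support := by
    intro h
    have := SimpleGraph.Walk.support_bypass_subset _ h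
    simp [SimpleGraph.Walk.mem_support_append_iff, hp, hq] at this
  let r : G.Path a b := ⟨(p.append q.reverse).bypass, SimpleGraph.Walk.bypass_isPath _⟩
  let s : G.Path a b := ⟨SimpleGraph.Walk.cons ha.symm (SimpleGraph.Walk.cons hb .nil), by
    simp [SimpleGraph.Walk.cons_isPath_iff, hab, hb.ne, ha.ne']⟩
  have hrs : r = s := hG.path_unique r s
  apply hr
  change v ∈ (r : G.Walk a b).support
  rw [hrs]
  simp [s]

theorem isolated_of_later_neighbor_times {V : Type*} [Fintype V] [DecidableEq V]
    (T : SimpleGraph V) [DecidableRel T.Adj] (htree : T.IsTree)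
    (F : ℕ → ℕ) (tstar : ℕ) (v : V) (Q P : Finset V)
    (hQiso : ∀ w : V, w ≠ v → ∀ t : ℕ, t ≤ tstar → v ∉ perc T F (insert w Q) t)
    (hvP : v ∉ P)
    (j : V) (hj : j ∈ T.neighborFinset v)
    (heq : ∀ u ∈ T.neighborFinset v, u ≠ j → firstTime T F Q u = firstTime T F P u)
    (hle : firstTime T F Q j ≤ firstTime T F P j) :
    ∀ w : V, w ≠ v → ∀ t : ℕ, t ≤ tstar → v ∉ perc T F (insert w P) t := by
  intro w hw t
  have hPQ : ∀ u ∈ T.neighborFinset v, ∀ s, u ∈ perc T F P s → u ∈ perc T F Q s := by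
    intro u hu s hs
    rw [← firstTime_le_iff] at hs ⊢
    by_cases huj : u = j
    · subst huj
      exact hle.trans hs
    · rw [heq u hu huj]
      exact hs
  induction t with
  | zero =>
    intro _ h
    simp only [perc, Finset.mem_insert] at h
    exact h.elim (fun h => hw h.symm) hvP
  | succ t ih =>
    intro ht h
    have hvt := ih (by omega)
    simp only [perc, Finset.mem_union, Finset.mem_filter, Finset.mem_univ, true_and] at h
    replace h := h.resolve_left hvt
    obtain ⟨k, hk, hku⟩ : ∃ k ∈ T.neighborFinset v, ∀ u ∈ T.neighborFinset v,
        (∃ p : T.Walk u w, v ∉ p.support) → u = k := by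
      by_cases hex : ∃ k ∈ T.neighborFinset v, ∃ p : T.Walk k w, v ∉ p.support
      · obtain ⟨k, hk, hkp⟩ := hex
        refine ⟨k, hk, fun u hu hup => ?_⟩
        rw [SimpleGraph.mem_neighborFinset] at hk hu
        exact branch_unique T htree.IsAcyclic v w u k hu hk hup hkp
      · exact ⟨j, hj, fun u hu hup => absurd ⟨u, hu, hup⟩ hex⟩
    have hkv : k ≠ v := by
      rw [SimpleGraph.mem_neighborFinset] at hk
      exact hk.ne'
    refine hQiso k hkv (t + 1) ht ?_
    simp only [perc, Finset.mem_union, Finset.mem_filter, Finset.mem_univ, true_and]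
    refine Or.inr (h.trans (Finset.card_le_card ?_))
    intro x hx
    rw [Finset.mem_inter] at hx ⊢
    refine ⟨hx.1, ?_⟩
    by_cases hxk : x = k
    · subst hxk
      exact perc_mono_time T F _ (Nat.zero_le t) (by simp [perc])
    · have hxv : x ≠ v := by
        rintro rfl
        exact hvt hx.2
      exact perc_mono_set T F (Finset.subset_insert _ _) t (hPQ x hx.1 t
        (perc_branch T F P v w hw t hvt x hxv (fun hp => hxk (hku x hx.1 hp)) hx.2))
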